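/- The minimal time function T : X → (−∞, +∞] is convex if and only if the target set Ω is convex. -/

import Mathlib

open Set Filter Topology Pointwise
open scoped ENNReal

variable {X : Type*}

/-- Minimal time function `T(x) = inf{t ≥ 0 : Ω ∩ (x + tF) ≠ ∅}`, with `inf ∅ = ∞`. -/
noncomputable def mtime [NormedAddCommGroup X] [NormedSpace ℝ X]
    (Ω F : Set X) (x : X) : ℝ≥0∞ :=
  ⨅ (t : ℝ) (_ : 0 ≤ t ∧ ∃ q ∈ F, x + t • q ∈ Ω), ENNReal.ofReal t

/-- Minkowski gauge `ρ_F(u) = inf{t ≥ 0 : u ∈ tF}`, with `inf ∅ = ∞`. -/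
noncomputable def mgauge [NormedAddCommGroup X] [NormedSpace ℝ X]
    (F : Set X) (u : X) : ℝ≥0∞ :=
  ⨅ (t : ℝ) (_ : 0 ≤ t ∧ ∃ q ∈ F, u = t • q), ENNReal.ofReal t

/-- Enlargement `Ω_r = {x : T(x) ≤ r}` of the target set. -/
noncomputable def enl [NormedAddCommGroup X] [NormedSpace ℝ X]
    (Ω F : Set X) (r : ℝ) : Set X :=
  {x | mtime Ω F x ≤ ENNReal.ofReal r}

/-- Generalized (minimal time) projection `Π(x) = (x + T(x)·F) ∩ Ω`. -/
noncomputable def mproj [NormedAddCommGroup X] [NormedSpace ℝ X]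
    (Ω F : Set X) (x : X) : Set X :=
  {w | w ∈ Ω ∧ ∃ q ∈ F, w = x + (mtime Ω F x).toReal • q}

/-- Support function `σ_F(x*) = sup_{q ∈ F} ⟨x*, q⟩`. -/
noncomputable def suppFn [NormedAddCommGroup X] [NormedSpace ℝ X]
    (F : Set X) (p : X →L[ℝ] ℝ) : ℝ :=
  sSup ((fun q => p q) '' F)

/-- Dynamics bound `‖F‖ = sup{‖q‖ : q ∈ F}`. -/
noncomputable def dynBound [NormedAddCommGroup X] (F : Set X) : ℝ :=
  sSup ((fun q => ‖q‖) '' F)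

/-- Fréchet `ε`-subdifferential of `φ` at `xb`:
`liminf_{x→xb} (φ(x) − φ(xb) − ⟨x*, x−xb⟩)/‖x−xb‖ ≥ −ε`. -/
def fsub [NormedAddCommGroup X] [NormedSpace ℝ X]
    (φ : X → ℝ≥0∞) (ε : ℝ) (xb : X) : Set (X →L[ℝ] ℝ) :=
  {p | ∀ γ > (0:ℝ), ∃ δ > (0:ℝ), ∀ x, ‖x - xb‖ < δ →
    ENNReal.ofReal ((φ xb).toReal + p (x - xb) - (ε + γ) * ‖x - xb‖) ≤ φ x}

/-- Set of `ε`-normals to `Θ` at `xb ∈ Θ`. -/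
def enormal [NormedAddCommGroup X] [NormedSpace ℝ X]
    (Θ : Set X) (ε : ℝ) (xb : X) : Set (X →L[ℝ] ℝ) :=
  {p | ∀ γ > (0:ℝ), ∃ δ > (0:ℝ), ∀ x ∈ Θ, ‖x - xb‖ < δ →
    p (x - xb) ≤ (ε + γ) * ‖x - xb‖}

/-- Basic (limiting/Mordukhovich) normal cone. -/
def bnormal [NormedAddCommGroup X] [NormedSpace ℝ X]
    (Θ : Set X) (xb : X) : Set (X →L[ℝ] ℝ) :=
  {p | ∃ (ε : ℕ → ℝ) (x : ℕ → X) (ps : ℕ → X →L[ℝ] ℝ),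
    (∀ k, 0 ≤ ε k) ∧ Tendsto ε atTop (𝓝 0) ∧
    (∀ k, x k ∈ Θ) ∧ Tendsto x atTop (𝓝 xb) ∧
    (∀ k, ps k ∈ enormal Θ (ε k) (x k)) ∧
    (∀ v, Tendsto (fun k => ps k v) atTop (𝓝 (p v)))}

/-- Basic (limiting/Mordukhovich) subdifferential. -/
def bsub [NormedAddCommGroup X] [NormedSpace ℝ X]
    (φ : X → ℝ≥0∞) (xb : X) : Set (X →L[ℝ] ℝ) :=
  {p | ∃ (ε : ℕ → ℝ) (x : ℕ → X) (ps : ℕ → X →L[ℝ] ℝ),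
    (∀ k, 0 ≤ ε k) ∧ Tendsto ε atTop (𝓝 0) ∧
    Tendsto x atTop (𝓝 xb) ∧
    Tendsto (fun k => φ (x k)) atTop (𝓝 (φ xb)) ∧
    (∀ k, ps k ∈ fsub φ (ε k) (x k)) ∧
    (∀ v, Tendsto (fun k => ps k v) atTop (𝓝 (p v)))}

/-- Singular (Mordukhovich) subdifferential. -/
def ssub [NormedAddCommGroup X] [NormedSpace ℝ X]
    (φ : X → ℝ≥0∞) (xb : X) : Set (X →L[ℝ] ℝ) :=
  {p | ∃ (ε lam : ℕ → ℝ) (x : ℕ → X) (ps : ℕ → X →L[ℝ] ℝ),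
    (∀ k, 0 ≤ ε k) ∧ Tendsto ε atTop (𝓝 0) ∧
    (∀ k, 0 < lam k) ∧ Tendsto lam atTop (𝓝 0) ∧
    Tendsto x atTop (𝓝 xb) ∧
    Tendsto (fun k => φ (x k)) atTop (𝓝 (φ xb)) ∧
    (∀ k, ps k ∈ fsub φ (ε k) (x k)) ∧
    (∀ v, Tendsto (fun k => lam k * ps k v) atTop (𝓝 (p v)))}

/-- Subdifferential of convex analysis (for `ℝ≥0∞`-valued convex functions,
finite at the reference point). -/
def csub [NormedAddCommGroup X] [NormedSpace ℝ X]
    (φ : X → ℝ≥0∞) (xb : X) : Set (X →L[ℝ] ℝ) :=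
  {p | ∀ x, ENNReal.ofReal (p (x - xb) + (φ xb).toReal) ≤ φ x}

/-- Normal cone of convex analysis. -/
def cnormal [NormedAddCommGroup X] [NormedSpace ℝ X]
    (Θ : Set X) (xb : X) : Set (X →L[ℝ] ℝ) :=
  {p | ∀ x ∈ Θ, p (x - xb) ≤ 0}

section MinimalTime

variable [NormedAddCommGroup X] [NormedSpace ℝ X] {Ω F : Set X} {x y : X}

theorem mtime_le_ofReal {t : ℝ} (ht : 0 ≤ t) {q : X} (hq : q ∈ F) (h : x + t • q ∈ Ω) :
    mtime Ω F x ≤ ENNReal.ofReal t :=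
  iInf₂_le t ⟨ht, q, hq, h⟩

theorem exists_of_mtime_lt {a : ℝ≥0∞} (h : mtime Ω F x < a) :
    ∃ t : ℝ, 0 ≤ t ∧ (∃ q ∈ F, x + t • q ∈ Ω) ∧ ENNReal.ofReal t < a := by
  simp only [mtime, iInf_lt_iff] at h
  obtain ⟨t, ⟨ht, hq⟩, hta⟩ := h
  exact ⟨t, ht, hq, hta⟩

theorem mtime_eq_zero_of_mem (hF : F.Nonempty) (hx : x ∈ Ω) : mtime Ω F x = 0 := by
  obtain ⟨q, hq⟩ := hF
  simpa using mtime_le_ofReal (t := 0) le_rfl hq (by simpa using hx)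

theorem mem_closure_of_mtime_eq_zero (hF : Bornology.IsBounded F) (h : mtime Ω F x = 0) :
    x ∈ closure Ω := by
  obtain ⟨M, hM, hFM⟩ := hF.exists_pos_norm_le
  refine Metric.mem_closure_iff.2 fun δ hδ => ?_
  have hpos : 0 < δ / M := div_pos hδ hM
  obtain ⟨t, ht, ⟨q, hq, hmem⟩, hlt⟩ :=
    exists_of_mtime_lt (h.trans_lt (ENNReal.ofReal_pos.2 hpos))
  refine ⟨_, hmem, ?_⟩
  rw [ENNReal.ofReal_lt_ofReal_iff hpos, lt_div_iff₀ hM] at hlt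
  rw [dist_self_add_right, norm_smul, Real.norm_of_nonneg ht]
  exact (mul_le_mul_of_nonneg_left (hFM q hq) ht).trans_lt hlt

/-- Nonnegative multiples of elements of a convex set add up to a multiple by the total weight. -/
theorem Convex.exists_add_smul_eq (hF : Convex ℝ F) {q r : X} (hq : q ∈ F) (hr : r ∈ F)
    {a b : ℝ} (ha : 0 ≤ a) (hb : 0 ≤ b) : ∃ p ∈ F, (a + b) • p = a • q + b • r := by
  have h : a • q + b • r ∈ (a + b) • F := by
    rw [hF.add_smul ha hb]
    exact add_mem_add (smul_mem_smul_set hq) (smul_mem_smul_set hr)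
  exact h

theorem mtime_combo_le (hΩ : Convex ℝ Ω) (hF : Convex ℝ F) {a b s t : ℝ}
    (ha : 0 ≤ a) (hb : 0 ≤ b) (hab : a + b = 1) (hs : 0 ≤ s) (ht : 0 ≤ t)
    (hx : ∃ q ∈ F, x + s • q ∈ Ω) (hy : ∃ q ∈ F, y + t • q ∈ Ω) :
    mtime Ω F (a • x + b • y) ≤ ENNReal.ofReal (a * s + b * t) := by
  obtain ⟨q, hq, hxq⟩ := hx
  obtain ⟨r, hr, hyr⟩ := hy
  obtain ⟨p, hp, hpe⟩ := hF.exists_add_smul_eq hq hr (mul_nonneg ha hs) (mul_nonneg hb ht)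
  refine mtime_le_ofReal (by positivity) hp ?_
  rw [hpe]
  convert hΩ hxq hyr ha hb hab using 1
  module

theorem mtime_convex (hΩ : Convex ℝ Ω) (hF : Convex ℝ F) (x y : X) {a b : ℝ}
    (ha : 0 ≤ a) (hb : 0 ≤ b) (hab : a + b = 1) :
    mtime Ω F (a • x + b • y) ≤
      ENNReal.ofReal a * mtime Ω F x + ENNReal.ofReal b * mtime Ω F y := by
  rcases ha.eq_or_lt with rfl | ha'
  · obtain rfl : b = 1 := by linarith
    simp
  rcases hb.eq_or_lt with rfl | hb'
  · obtain rfl : a = 1 := by linarith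
    simp
  rcases eq_or_ne (mtime Ω F x) ⊤ with hx | hx
  · simp [hx, ENNReal.mul_top, ha']
  rcases eq_or_ne (mtime Ω F y) ⊤ with hy | hy
  · simp [hy, ENNReal.mul_top, hb']
  refine ENNReal.le_of_forall_pos_le_add fun ε hε _ => ?_
  have hε' : (ε : ℝ≥0∞) ≠ 0 := by exact_mod_cast hε.ne'
  obtain ⟨s, hs, hsx, hsl⟩ := exists_of_mtime_lt (ENNReal.lt_add_right hx hε')
  obtain ⟨t, ht, hty, htl⟩ := exists_of_mtime_lt (ENNReal.lt_add_right hy hε')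
  calc mtime Ω F (a • x + b • y)
      ≤ ENNReal.ofReal (a * s + b * t) := mtime_combo_le hΩ hF ha hb hab hs ht hsx hty
    _ = ENNReal.ofReal a * ENNReal.ofReal s + ENNReal.ofReal b * ENNReal.ofReal t := by
        rw [ENNReal.ofReal_add (by positivity) (by positivity), ENNReal.ofReal_mul ha,
          ENNReal.ofReal_mul hb]
    _ ≤ ENNReal.ofReal a * (mtime Ω F x + ε) + ENNReal.ofReal b * (mtime Ω F y + ε) := by
        gcongr
    _ = ENNReal.ofReal a * mtime Ω F x + ENNReal.ofReal b * mtime Ω F y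
          + (ENNReal.ofReal a + ENNReal.ofReal b) * ε := by ring
    _ = _ := by rw [← ENNReal.ofReal_add ha hb, hab, ENNReal.ofReal_one, one_mul]

end MinimalTime

/-- Proposition 3.6: convexity of minimal time functions:
`T` is convex if and only if the target `Ω` is convex. -/
theorem mtime_convex_iff [NormedAddCommGroup X] [NormedSpace ℝ X] [CompleteSpace X]
    (Ω F : Set X) (hΩne : Ω.Nonempty) (hΩcl : IsClosed Ω)
    (hFne : F.Nonempty) (hFcl : IsClosed F) (hFbd : Bornology.IsBounded F)
    (hFcv : Convex ℝ F) :
    (∀ x y : X, ∀ l : ℝ, 0 ≤ l → l ≤ 1 →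
      mtime Ω F (l • x + (1 - l) • y) ≤
        ENNReal.ofReal l * mtime Ω F x + ENNReal.ofReal (1 - l) * mtime Ω F y) ↔
      Convex ℝ Ω := by
  refine ⟨fun h x hx y hy a b ha hb hab => ?_, fun hΩ x y l hl hl' =>
    mtime_convex hΩ hFcv x y hl (sub_nonneg.2 hl') (add_sub_cancel l 1)⟩
  obtain rfl : b = 1 - a := by linarith
  rw [← hΩcl.closure_eq]
  refine mem_closure_of_mtime_eq_zero hFbd ?_
  simpa [mtime_eq_zero_of_mem hFne hx, mtime_eq_zero_of_mem hFne hy]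
    using h x y a ha (by linarith)
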